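/- Let R be a left coherent ring and let (𝒳,𝒴) and (𝒳₁,𝒴₁) be torsion pairs in fp(R-Mod) such that lim→𝒳 = lim→𝒳₁ and lim→𝒴 = lim→𝒴₁. Then 𝒳 = 𝒳₁ and 𝒴 = 𝒴₁. In other words, the assignment (𝒳,𝒴) ↦ (lim→𝒳, lim→𝒴) is injective on torsion pairs in fp(R-Mod). -/

import Mathlib

open CategoryTheory Limits DirectSum

universe w u

variable (R : Type u) [Ring R]

/-- `R` is left coherent: every finitely generated left ideal is finitely presented
as a left `R`-module. -/
def LeftCoherent : Prop :=
  ∀ I : Submodule R R, I.FG → Module.FinitePresentation R I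

/-- A torsion pair `(X, Y)` in the category `fp(R-Mod)` of finitely presented left
`R`-modules. -/
structure FpTorsionPair (X Y : ModuleCat.{u} R → Prop) : Prop where
  fp_left : ∀ M, X M → Module.FinitePresentation R M
  fp_right : ∀ M, Y M → Module.FinitePresentation R M
  iso_closed_left : ∀ {M N : ModuleCat.{u} R}, (M ≅ N) → X M → X N
  iso_closed_right : ∀ {M N : ModuleCat.{u} R}, (M ≅ N) → Y M → Y N
  hom_eq_zero : ∀ {M N : ModuleCat.{u} R}, X M → Y N → ∀ f : M →ₗ[R] N, f = 0
  exists_torsion_submodule : ∀ M : ModuleCat.{u} R, Module.FinitePresentation R M →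
    ∃ t : Submodule R M, X (ModuleCat.of R t) ∧ Y (ModuleCat.of R (M ⧸ t))

/-- A presentation of `M` as a direct limit (filtered colimit) of modules in the class `X`. -/
structure DirectLimitPresentation (X : ModuleCat.{u} R → Prop) (M : ModuleCat.{u} R) where
  J : Type u
  [instCat : SmallCategory J]
  [instFil : IsFiltered J]
  D : J ⥤ ModuleCat.{u} R
  c : Cocone D
  isColimit : IsColimit c
  mem : ∀ j, X (D.obj j)
  iso : c.pt ≅ M

/-- `lim→ X`: the class of modules isomorphic to a direct limit of modules in `X`. -/
def LimClass (X : ModuleCat.{u} R → Prop) (M : ModuleCat.{u} R) : Prop :=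
  Nonempty (DirectLimitPresentation R X M)

/-- A linear map from a finitely presented module to a filtered colimit of modules factors
through some stage of the colimit. -/
lemma Module.FinitePresentation.exists_factor_of_isColimit {J : Type u} [SmallCategory J]
    [IsFiltered J] {D : J ⥤ ModuleCat.{u} R} {c : Cocone D} (hc : IsColimit c)
    {M : Type u} [AddCommGroup M] [Module R M] [Module.FinitePresentation R M]
    (g : M →ₗ[R] c.pt) :
    ∃ (j : J) (h : M →ₗ[R] D.obj j), (c.ι.app j).hom ∘ₗ h = g := by
  classical
  obtain ⟨n, f, hf⟩ := Module.Finite.exists_fin' R M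
  obtain ⟨S, hS⟩ := Module.FinitePresentation.fg_ker f hf
  obtain ⟨j, φ, hφ⟩ : ∃ (j : J) (φ : (Fin n → R) →ₗ[R] D.obj j),
      (c.ι.app j).hom ∘ₗ φ = g ∘ₗ f := by
    choose j x hx using fun i : Fin n =>
      Concrete.isColimit_exists_rep D hc (g (f (Pi.single i 1)))
    obtain ⟨k, hk⟩ := IsFiltered.sup_objs_exists (Finset.univ.image j)
    have a : ∀ i, j i ⟶ k := fun i => (hk (Finset.mem_image_of_mem j (Finset.mem_univ i))).some
    refine ⟨k, (Pi.basisFun R (Fin n)).constr ℕ fun i => D.map (a i) (x i), ?_⟩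
    refine (Pi.basisFun R (Fin n)).ext fun i => ?_
    rw [LinearMap.comp_apply, Module.Basis.constr_basis, LinearMap.comp_apply, Pi.basisFun_apply,
      ← hx i, ← c.w (a i)]
    rfl
  have hkill : ∀ T : Finset (Fin n → R), (∀ v ∈ T, f v = 0) →
      ∃ (k : J) (a : j ⟶ k), ∀ v ∈ T, (D.map a).hom (φ v) = 0 := by
    intro T
    induction T using Finset.induction_on with
    | empty => exact fun _ => ⟨j, 𝟙 j, by simp⟩
    | insert v T _ ih =>
      intro hT
      obtain ⟨k, a, ha⟩ := ih fun w hw => hT w (Finset.mem_insert_of_mem hw)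
      have hv : c.ι.app k ((D.map a).hom (φ v)) = c.ι.app k (0 : D.obj k) := by
        have h₁ := LinearMap.congr_fun hφ v
        rw [← c.w a] at h₁
        rw [map_zero]
        simpa [hT v (Finset.mem_insert_self v T)] using h₁
      obtain ⟨l, b, b', hb⟩ := Concrete.isColimit_exists_of_rep_eq D hc _ _ hv
      refine ⟨l, a ≫ b, fun w hw => ?_⟩
      rw [D.map_comp, ModuleCat.hom_comp, LinearMap.comp_apply]
      obtain rfl | hw := Finset.mem_insert.1 hw
      · exact hb.trans (map_zero (D.map b').hom)
      · rw [ha w hw, map_zero]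
  obtain ⟨k, a, ha⟩ := hkill S fun v hv => LinearMap.mem_ker.1 (hS ▸ Submodule.subset_span hv)
  have hle : LinearMap.ker f ≤ LinearMap.ker ((D.map a).hom ∘ₗ φ) := by
    rw [← hS, Submodule.span_le]
    exact ha
  refine ⟨k, (LinearMap.ker f).liftQ _ hle ∘ₗ (f.quotKerEquivOfSurjective hf).symm, ?_⟩
  refine LinearMap.ext fun m => ?_
  obtain ⟨v, rfl⟩ := hf m
  have hv : (f.quotKerEquivOfSurjective hf).symm (f v) = (LinearMap.ker f).mkQ v := by
    rw [LinearEquiv.symm_apply_eq]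
    rfl
  have h₁ := LinearMap.congr_fun hφ v
  rw [← c.w a] at h₁
  simpa [hv] using h₁

variable {R} in
/-- A class of modules is contained in its closure under direct limits. -/
lemma LimClass.of_mem {X : ModuleCat.{u} R → Prop} {M : ModuleCat.{u} R} (hM : X M) :
    LimClass R X M :=
  ⟨{ J := Discrete PUnit.{u + 1}
     D := (Functor.const _).obj M
     c := constCocone _ M
     isColimit := isColimitConstCocone _ M
     mem := fun _ => hM
     iso := Iso.refl M }⟩

variable {R} in
/-- A finitely presented direct limit of modules in `X` is a retract of a module in `X`. -/
lemma LimClass.exists_retract {X : ModuleCat.{u} R → Prop} {M : ModuleCat.{u} R}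
    [Module.FinitePresentation R M] (hM : LimClass R X M) :
    ∃ (N : ModuleCat.{u} R) (i : M →ₗ[R] N) (r : N →ₗ[R] M), X N ∧ r ∘ₗ i = LinearMap.id := by
  obtain ⟨P⟩ := hM
  let := P.instCat
  have := P.instFil
  obtain ⟨j, h, hh⟩ :=
    Module.FinitePresentation.exists_factor_of_isColimit R P.isColimit P.iso.inv.hom
  refine ⟨P.D.obj j, h, P.iso.hom.hom ∘ₗ (P.c.ι.app j).hom, P.mem j, ?_⟩
  rw [LinearMap.comp_assoc, hh, ← ModuleCat.hom_comp, P.iso.inv_hom_id, ModuleCat.hom_id]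

namespace FpTorsionPair

variable {R} {X Y : ModuleCat.{u} R → Prop}

/-- The torsion class of a torsion pair contains every finitely presented quotient of a torsion
module. -/
lemma left_of_surjective (h : FpTorsionPair R X Y) {M N : ModuleCat.{u} R}
    [Module.FinitePresentation R M] (hN : X N) (r : N →ₗ[R] M) (hr : Function.Surjective r) :
    X M := by
  obtain ⟨t, ht, ht'⟩ := h.exists_torsion_submodule M ‹_›
  have htop : t = ⊤ := by
    refine Submodule.eq_top_iff'.2 fun m => ?_
    obtain ⟨n, rfl⟩ := hr m
    exact (Submodule.Quotient.mk_eq_zero t).1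
      (LinearMap.congr_fun (h.hom_eq_zero hN ht' (t.mkQ ∘ₗ r)) n)
  exact h.iso_closed_left (LinearEquiv.ofTop t htop).toModuleIso ht

/-- The torsion-free class of a torsion pair contains every finitely presented submodule of a
torsion-free module. -/
lemma right_of_injective (h : FpTorsionPair R X Y) {M N : ModuleCat.{u} R}
    [Module.FinitePresentation R M] (hN : Y N) (i : M →ₗ[R] N) (hi : Function.Injective i) :
    Y M := by
  obtain ⟨t, ht, ht'⟩ := h.exists_torsion_submodule M ‹_›
  have hbot : t = ⊥ := by
    refine (Submodule.eq_bot_iff t).2 fun m hm => hi ?_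
    rw [map_zero]
    exact LinearMap.congr_fun (h.hom_eq_zero ht hN (i ∘ₗ t.subtype)) ⟨m, hm⟩
  exact h.iso_closed_right (Submodule.quotEquivOfEqBot t hbot).toModuleIso ht'

lemma left_of_limClass (h : FpTorsionPair R X Y) {M : ModuleCat.{u} R}
    [Module.FinitePresentation R M] (hM : LimClass R X M) : X M := by
  obtain ⟨N, i, r, hN, hri⟩ := hM.exists_retract
  exact h.left_of_surjective hN r fun m => ⟨i m, LinearMap.congr_fun hri m⟩

lemma right_of_limClass (h : FpTorsionPair R X Y) {M : ModuleCat.{u} R}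
    [Module.FinitePresentation R M] (hM : LimClass R Y M) : Y M := by
  obtain ⟨N, i, r, hN, hri⟩ := hM.exists_retract
  exact h.right_of_injective hN i (Function.LeftInverse.injective (LinearMap.congr_fun hri))

end FpTorsionPair

/-- **Theorem.** Over a left coherent ring, the assignment
`(X, Y) ↦ (lim→ X, lim→ Y)` is injective on torsion pairs in `fp(R-Mod)`. -/
theorem coherent_limClass_injective (hcoh : LeftCoherent R)
    (X Y X₁ Y₁ : ModuleCat.{u} R → Prop)
    (hfp : FpTorsionPair R X Y) (hfp₁ : FpTorsionPair R X₁ Y₁)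
    (hX : ∀ M : ModuleCat.{u} R, LimClass R X M ↔ LimClass R X₁ M)
    (hY : ∀ M : ModuleCat.{u} R, LimClass R Y M ↔ LimClass R Y₁ M) :
    (∀ M : ModuleCat.{u} R, X M ↔ X₁ M) ∧ (∀ M : ModuleCat.{u} R, Y M ↔ Y₁ M) := by
  refine ⟨fun M => ⟨fun hM => ?_, fun hM => ?_⟩, fun M => ⟨fun hM => ?_, fun hM => ?_⟩⟩
  · have := hfp.fp_left M hM
    exact hfp₁.left_of_limClass ((hX M).1 (.of_mem hM))
  · have := hfp₁.fp_left M hM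
    exact hfp.left_of_limClass ((hX M).2 (.of_mem hM))
  · have := hfp.fp_right M hM
    exact hfp₁.right_of_limClass ((hY M).1 (.of_mem hM))
  · have := hfp₁.fp_right M hM
    exact hfp.right_of_limClass ((hY M).2 (.of_mem hM))
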